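/- Let p ≥ 7 be a prime such that p divides the numerator of the Bernoulli number B_{p-3} (i.e. the p-adic valuation of B_{p-3} is at least 1, or B_{p-3} = 0). Then binomial(2p-1, p-1) ≡ 1 (mod p^4), i.e. p^4 divides binomial(2p-1, p-1) − 1 as integers. -/

import Mathlib

open Finset

section CommRing

variable {R : Type*} [CommRing R]

theorem sq_dvd_prod_one_add_mul_sub {ι : Type*} (s : Finset ι) (x : R) (u : ι → R) :
    x ^ 2 ∣ ∏ i ∈ s, (1 + x * u i) - 1 - x * ∑ i ∈ s, u i := by
  classical
  induction s using Finset.induction_on with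
  | empty => simp
  | insert a s ha ih =>
    obtain ⟨c, hc⟩ := ih
    rw [prod_insert ha, sum_insert ha]
    exact ⟨c + u a * ∑ i ∈ s, u i + x * u a * c, by linear_combination (1 + x * u a) * hc⟩

/-- The sum over `1, …, 2 * h` split into its even and odd terms, which are the residues
modulo `2 * h + 1` of the doubles of `1, …, h` and of `h + 1, …, 2 * h`. -/
theorem sum_range_two_mul_even_add_odd {M : Type*} [AddCommMonoid M] (f : ℕ → M) (h : ℕ) :
    ∑ j ∈ range (2 * h), f (j + 1) =
      ∑ j ∈ range h, f (2 * (j + 1)) + ∑ j ∈ range h, f (2 * j + 1) := by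
  induction h with
  | zero => simp
  | succ h ih =>
    rw [show 2 * (h + 1) = 2 * h + 1 + 1 by ring, sum_range_succ, sum_range_succ, ih,
      sum_range_succ, sum_range_succ, show 2 * (h + 1) = 2 * h + 1 + 1 by ring]
    ac_rfl

theorem sum_range_two_mul_halves (f : ℕ → R) (h : ℕ) :
    ∑ j ∈ range (2 * h), f (j + 1) =
      ∑ j ∈ range h, f (j + 1) + ∑ j ∈ range h, f (h + j + 1) := by
  rw [two_mul, sum_range_add]

variable {h : ℕ} {v : ℕ → R}

theorem sq_dvd_sum_pow_doubling (h n : ℕ) :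
    ((2 * h + 1 : ℕ) : R) ^ 2 ∣
      ∑ j ∈ range (2 * h), ((j + 1 : ℕ) : R) ^ n
        - 2 ^ n * ∑ j ∈ range (2 * h), ((j + 1 : ℕ) : R) ^ n
        + n * 2 ^ (n - 1) * (2 * h + 1 : ℕ) *
          ∑ j ∈ range h, ((h + j + 1 : ℕ) : R) ^ (n - 1) := by
  have key : ∀ j ∈ range h, ((2 * h + 1 : ℕ) : R) ^ 2 ∣
      ((2 * j + 1 : ℕ) : R) ^ n - 2 ^ n * ((h + j + 1 : ℕ) : R) ^ n
        + n * 2 ^ (n - 1) * (2 * h + 1 : ℕ) * ((h + j + 1 : ℕ) : R) ^ (n - 1) := by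
    intro j _
    obtain ⟨c, hc⟩ := Polynomial.powAddExpansion
      (2 * ((h + j + 1 : ℕ) : R)) (-((2 * h + 1 : ℕ) : R)) n
    have e : ((2 * j + 1 : ℕ) : R) = 2 * ((h + j + 1 : ℕ) : R) + (-((2 * h + 1 : ℕ) : R)) := by
      push_cast; ring
    rw [e, hc, mul_pow, mul_pow]
    exact ⟨c, by ring⟩
  convert dvd_sum key using 1
  rw [sum_add_distrib, sum_sub_distrib, ← mul_sum, ← mul_sum]
  nth_rewrite 1 [sum_range_two_mul_even_add_odd (fun k => (k : R) ^ n)]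
  rw [sum_range_two_mul_halves (fun k => (k : R) ^ n)]
  have : ∑ j ∈ range h, ((2 * (j + 1) : ℕ) : R) ^ n
      = 2 ^ n * ∑ j ∈ range h, ((j + 1 : ℕ) : R) ^ n := by
    rw [mul_sum]
    exact sum_congr rfl fun j _ => by push_cast; rw [mul_pow]
  rw [this]
  ring

theorem sq_dvd_sum_inv_sq_doubling
    (hv : ∀ k, 0 < k → k < 2 * h + 1 → (k : R) * v k = 1) :
    ((2 * h + 1 : ℕ) : R) ^ 2 ∣
      3 * ∑ j ∈ range (2 * h), v (j + 1) ^ 2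
        - (2 * h + 1 : ℕ) * ∑ j ∈ range h, v (h + j + 1) ^ 3 := by
  have heven : ∀ j ∈ range h, 4 * v (2 * (j + 1)) ^ 2 = v (j + 1) ^ 2 := by
    intro j hj
    have hj := mem_range.1 hj
    have h1 := hv (2 * (j + 1)) (by omega) (by omega)
    have h2 := hv (j + 1) (by omega) (by omega)
    push_cast at h1 h2
    have : 2 * v (2 * (j + 1)) = v (j + 1) := by
      linear_combination v (j + 1) * h1 - 2 * v (2 * (j + 1)) * h2
    rw [← this]; ring
  have hodd : ∀ j ∈ range h, ((2 * h + 1 : ℕ) : R) ^ 2 ∣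
      4 * v (2 * j + 1) ^ 2 - v (h + j + 1) ^ 2 - (2 * h + 1 : ℕ) * v (h + j + 1) ^ 3 := by
    intro j hj
    have hj := mem_range.1 hj
    have h1 := hv (2 * j + 1) (by omega) (by omega)
    have h2 := hv (h + j + 1) (by omega) (by omega)
    have e : ((2 * j + 1 : ℕ) : R) = 2 * ((h + j + 1 : ℕ) : R) - ((2 * h + 1 : ℕ) : R) := by
      push_cast; ring
    rw [e] at h1
    generalize ((h + j + 1 : ℕ) : R) = k at *
    generalize ((2 * h + 1 : ℕ) : R) = q at *
    generalize v (2 * j + 1) = a at *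
    generalize v (h + j + 1) = b at *
    have hab : 2 * a = b + q * a * b := by linear_combination b * h1 - 2 * a * h2
    refine ⟨a ^ 2 * b ^ 2 + a * b ^ 3, ?_⟩
    linear_combination (2 * a + b + q * a * b + q * b ^ 2) * hab
  convert dvd_sum hodd using 1
  rw [sum_sub_distrib, sum_sub_distrib, ← mul_sum, ← mul_sum]
  have e1 := sum_range_two_mul_even_add_odd (fun k => v k ^ 2) h
  have e2 := sum_range_two_mul_halves (fun k => v k ^ 2) h
  have e3 := sum_congr rfl heven
  rw [← mul_sum] at e3
  linear_combination 4 * e1 - e2 + e3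

theorem inv_add_inv_reflect
    (hv : ∀ k, 0 < k → k < 2 * h + 1 → (k : R) * v k = 1) {j : ℕ} (hj : j < 2 * h) :
    v (j + 1) + v (2 * h - 1 - j + 1)
      = (2 * h + 1 : ℕ) * (v (j + 1) * v (2 * h - 1 - j + 1)) := by
  have h1 := hv (j + 1) (by omega) (by omega)
  have h2 := hv (2 * h - 1 - j + 1) (by omega) (by omega)
  have e : ((2 * h + 1 : ℕ) : R) = ((j + 1 : ℕ) : R) + ((2 * h - 1 - j + 1 : ℕ) : R) := by
    rw [← Nat.cast_add]; congr 1; omega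
  rw [e]
  linear_combination -v (2 * h - 1 - j + 1) * h1 - v (j + 1) * h2

theorem dvd_two_mul_sum_inv_cube
    (hv : ∀ k, 0 < k → k < 2 * h + 1 → (k : R) * v k = 1) :
    ((2 * h + 1 : ℕ) : R) ∣ 2 * ∑ j ∈ range (2 * h), v (j + 1) ^ 3 := by
  have e := sum_range_reflect (fun j => v (j + 1) ^ 3) (2 * h)
  rw [two_mul (∑ j ∈ range (2 * h), v (j + 1) ^ 3)]
  nth_rewrite 2 [← e]
  rw [← sum_add_distrib]
  refine dvd_sum fun j hj => ?_
  have := inv_add_inv_reflect hv (mem_range.1 hj)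
  refine ⟨v (j + 1) * v (2 * h - 1 - j + 1) * (v (j + 1) ^ 2
    - v (j + 1) * v (2 * h - 1 - j + 1) + v (2 * h - 1 - j + 1) ^ 2), ?_⟩
  linear_combination (v (j + 1) ^ 2
    - v (j + 1) * v (2 * h - 1 - j + 1) + v (2 * h - 1 - j + 1) ^ 2) * this

theorem sq_dvd_sum_inv_mul_inv_reflect
    (hv : ∀ k, 0 < k → k < 2 * h + 1 → (k : R) * v k = 1) :
    ((2 * h + 1 : ℕ) : R) ^ 2 ∣
      ∑ j ∈ range (2 * h), v (j + 1) * v (2 * h - 1 - j + 1)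
        + ∑ j ∈ range (2 * h), v (j + 1) ^ 2
        + (2 * h + 1 : ℕ) * ∑ j ∈ range (2 * h), v (j + 1) ^ 3 := by
  rw [mul_sum, ← sum_add_distrib, ← sum_add_distrib]
  refine dvd_sum fun j hj => ?_
  have := inv_add_inv_reflect hv (mem_range.1 hj)
  generalize ((2 * h + 1 : ℕ) : R) = q at *
  generalize v (j + 1) = a at *
  generalize v (2 * h - 1 - j + 1) = b at *
  exact ⟨a ^ 3 * b, by linear_combination (a + q * a ^ 2) * this⟩

theorem choose_eq_prod_one_add_mul_inv
    (hv : ∀ k, 0 < k → k < 2 * h + 1 → (k : R) * v k = 1) :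
    ((Nat.choose (2 * h + 1 + 2 * h) (2 * h) : ℕ) : R)
      = ∏ j ∈ range (2 * h), (1 + (2 * h + 1 : ℕ) * v (j + 1)) := by
  have h1 := congrArg (Nat.cast : ℕ → R)
    (Nat.ascFactorial_eq_factorial_mul_choose (2 * h + 1) (2 * h))
  rw [Nat.ascFactorial_eq_prod_range, ← prod_range_add_one_eq_factorial, Nat.cast_mul,
    Nat.cast_prod, Nat.cast_prod] at h1
  have h2 : ∏ j ∈ range (2 * h), v (j + 1) * ((j + 1 : ℕ) : R) = 1 :=
    prod_eq_one fun j hj => by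
      rw [mul_comm]; exact hv _ (by omega) (by have := mem_range.1 hj; omega)
  rw [prod_mul_distrib] at h2
  have h3 : ∏ j ∈ range (2 * h), (1 + ((2 * h + 1 : ℕ) : R) * v (j + 1))
      = (∏ j ∈ range (2 * h), v (j + 1)) * ∏ j ∈ range (2 * h), ((2 * h + 1 + 1 + j : ℕ) : R) := by
    rw [← prod_mul_distrib]
    refine prod_congr rfl fun j hj => ?_
    have := hv (j + 1) (by omega) (by have := mem_range.1 hj; omega)
    push_cast at this ⊢
    linear_combination -this
  rw [h3, h1, ← mul_assoc, h2, one_mul]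

theorem choose_sq_eq_prod
    (hv : ∀ k, 0 < k → k < 2 * h + 1 → (k : R) * v k = 1) :
    ((Nat.choose (2 * h + 1 + 2 * h) (2 * h) : ℕ) : R) ^ 2
      = ∏ j ∈ range (2 * h),
        (1 + ((2 * h + 1 : ℕ) : R) ^ 2 * (2 * (v (j + 1) * v (2 * h - 1 - j + 1)))) := by
  rw [choose_eq_prod_one_add_mul_inv hv, sq]
  nth_rewrite 2 [← prod_range_reflect]
  rw [← prod_mul_distrib]
  refine prod_congr rfl fun j hj => ?_
  linear_combination ((2 * h + 1 : ℕ) : R) * inv_add_inv_reflect hv (mem_range.1 hj)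

end CommRing

section Padic

variable {p : ℕ} [hp : Fact p.Prime]

theorem inv_natCast_mem_padicIntSubring {k : ℕ} (h0 : 0 < k) (hk : k < p) :
    ((k : ℚ_[p]))⁻¹ ∈ PadicInt.subring p := by
  rw [PadicInt.mem_subring_iff, norm_inv, Padic.norm_natCast_eq_one_iff.2
    (Nat.coprime_of_lt_prime h0.ne' hk hp.out), inv_one]

theorem bernoulli'_mem_padicIntSubring (n : ℕ) (hn : n + 1 < p) :
    ((bernoulli' n : ℚ) : ℚ_[p]) ∈ PadicInt.subring p := by
  induction n using Nat.strong_induction_on with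
  | _ n ih =>
    rw [bernoulli'_def]
    push_cast
    refine sub_mem (one_mem _) (sum_mem fun k hk => ?_)
    have hk := mem_range.1 hk
    refine mul_mem ?_ (ih k hk (by omega))
    rw [div_eq_mul_inv]
    refine mul_mem (natCast_mem _ _) ?_
    have := inv_natCast_mem_padicIntSubring (p := p) (k := n - k + 1) (by omega) (by omega)
    rwa [Nat.cast_add, Nat.cast_sub hk.le, Nat.cast_one] at this

theorem bernoulli_mem_padicIntSubring (n : ℕ) (hn : n + 1 < p) :
    ((bernoulli n : ℚ) : ℚ_[p]) ∈ PadicInt.subring p := by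
  rw [bernoulli]
  push_cast
  exact mul_mem (pow_mem (neg_mem (one_mem _)) _) (bernoulli'_mem_padicIntSubring n hn)

theorem ratCast_div_prime_mem_padicIntSubring {q : ℚ} (hq : q = 0 ∨ 1 ≤ padicValRat p q) :
    (q : ℚ_[p]) / p ∈ PadicInt.subring p := by
  rcases eq_or_ne q 0 with rfl | h0
  · simp
  have h1 := hq.resolve_left h0
  have hp1 : (1 : ℝ) < p := mod_cast hp.out.one_lt
  rw [PadicInt.mem_subring_iff, norm_div, Padic.norm_p, Padic.eq_padicNorm,
    padicNorm.eq_zpow_of_nonzero h0, div_inv_eq_mul]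
  push_cast
  rw [← zpow_add_one₀ (by positivity)]
  exact zpow_le_one_of_nonpos₀ hp1.le (by omega)

theorem sq_dvd_sum_range_pow {n : ℕ} (hn : 0 < n) (hnp : n + 1 < p)
    (hB : bernoulli n = 0 ∨ 1 ≤ padicValRat p (bernoulli n)) :
    (p : ℤ_[p]) ^ 2 ∣ ∑ j ∈ range (p - 1), ((j + 1 : ℕ) : ℤ_[p]) ^ n := by
  have hp0 : (p : ℚ_[p]) ≠ 0 := mod_cast hp.out.ne_zero
  have hinv := inv_natCast_mem_padicIntSubring (p := p) (k := n + 1) (by omega) hnp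
  have hF := congrArg (Rat.cast : ℚ → ℚ_[p]) (sum_range_pow p n)
  push_cast at hF
  have hmem : (∑ k ∈ range p, (k : ℚ_[p]) ^ n) / p ^ 2 ∈ PadicInt.subring p := by
    rw [hF, sum_div]
    refine sum_mem fun i hi => ?_
    have hi := mem_range.1 hi
    rcases Nat.lt_succ_iff_lt_or_eq.1 hi with hlt | rfl
    · obtain ⟨m, hm⟩ : ∃ m, n + 1 - i = m + 2 := ⟨n - 1 - i, by omega⟩
      have : (bernoulli i : ℚ_[p]) * ((n + 1).choose i) * p ^ (n + 1 - i) / (n + 1) / p ^ 2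
          = bernoulli i * ((n + 1).choose i) * p ^ m * ((n + 1 : ℕ) : ℚ_[p])⁻¹ := by
        rw [hm, pow_add]; push_cast; field_simp
      rw [this]
      exact mul_mem (mul_mem (mul_mem (bernoulli_mem_padicIntSubring i (by omega))
        (natCast_mem _ _)) (pow_mem (natCast_mem _ _) _)) hinv
    · have : (bernoulli i : ℚ_[p]) * ((i + 1).choose i) * p ^ (i + 1 - i) / (i + 1) / p ^ 2
          = bernoulli i / p * ((i + 1).choose i) * ((i + 1 : ℕ) : ℚ_[p])⁻¹ := by
        rw [Nat.add_sub_cancel_left]; push_cast; field_simp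
      rw [this]
      exact mul_mem (mul_mem (ratCast_div_prime_mem_padicIntSubring hB) (natCast_mem _ _)) hinv
  have hshift : ∑ k ∈ range p, (k : ℚ_[p]) ^ n
      = ∑ j ∈ range (p - 1), ((j + 1 : ℕ) : ℚ_[p]) ^ n := by
    rw [show range p = range (p - 1 + 1) by rw [Nat.sub_add_cancel hp.out.one_le],
      sum_range_succ']
    simp [hn.ne']
  obtain ⟨c, hc⟩ : ∃ c : ℤ_[p], (c : ℚ_[p]) = (∑ k ∈ range p, (k : ℚ_[p]) ^ n) / p ^ 2 :=
    ⟨⟨_, hmem⟩, rfl⟩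
  refine ⟨c, PadicInt.ext ?_⟩
  rw [PadicInt.coe_mul, hc, PadicInt.coe_pow, PadicInt.coe_natCast,
    mul_div_cancel₀ _ (pow_ne_zero 2 hp0), hshift]
  simp

theorem exists_padicInt_inv :
    ∃ v : ℕ → ℤ_[p], ∀ k, 0 < k → k < p → (k : ℤ_[p]) * v k = 1 := by
  have : ∀ k : ℕ, ∃ w : ℤ_[p], 0 < k → k < p → (k : ℤ_[p]) * w = 1 := fun k => by
    by_cases hk : 0 < k ∧ k < p
    · have hu : IsUnit (k : ℤ_[p]) := by
        rw [PadicInt.isUnit_iff, PadicInt.norm_natCast_eq_one_iff]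
        exact (Nat.coprime_of_lt_prime hk.1.ne' hk.2 hp.out)
      obtain ⟨w, hw⟩ := hu.exists_right_inv
      exact ⟨w, fun _ _ => hw⟩
    · exact ⟨0, fun h0 h1 => (hk ⟨h0, h1⟩).elim⟩
  choose v hv using this
  exact ⟨v, hv⟩

theorem padicInt_dvd_of_dvd_natCast_mul {q x : ℤ_[p]} {k : ℕ} (h0 : 0 < k) (hk : k < p)
    (h : q ∣ k * x) : q ∣ x := by
  obtain ⟨v, hv⟩ := exists_padicInt_inv (p := p)
  have := h.mul_left (v k)
  rwa [← mul_assoc, mul_comm (v k), hv k h0 hk, one_mul] at this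

theorem padicInt_dvd_pow_sub_inv_cube {k : ℕ} {w : ℤ_[p]} (h4 : 4 ≤ p) (h0 : 0 < k) (hk : k < p)
    (hw : (k : ℤ_[p]) * w = 1) : (p : ℤ_[p]) ∣ (k : ℤ_[p]) ^ (p - 4) - w ^ 3 := by
  have hcop : IsCoprime (k : ℤ) p :=
    Nat.isCoprime_iff_coprime.2 (Nat.coprime_of_lt_prime h0.ne' hk hp.out).symm
  have h1 := (Int.ModEq.pow_card_sub_one_eq_one hp.out hcop).symm.dvd
  have h2 := map_dvd (Int.castRingHom ℤ_[p]) h1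
  simp only [map_sub, map_pow, map_natCast, map_one] at h2
  obtain ⟨m, rfl⟩ : ∃ m, p = m + 4 := ⟨p - 4, by omega⟩
  rw [show m + 4 - 1 = m + 3 by omega] at h2
  rw [Nat.add_sub_cancel]
  have e : (k : ℤ_[m + 4]) ^ m = w ^ 3 * (k : ℤ_[m + 4]) ^ (m + 3) := by
    rw [pow_add, mul_comm, mul_assoc, ← mul_pow, hw, one_pow, mul_one]
  rw [e, ← mul_sub_one]
  exact h2.mul_left _

theorem sq_dvd_sum_inv_mul_inv_reflect_of_bernoulli {h : ℕ} (hph : p = 2 * h + 1) (h7 : 7 ≤ p)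
    (hB : bernoulli (p - 3) = 0 ∨ 1 ≤ padicValRat p (bernoulli (p - 3)))
    {v : ℕ → ℤ_[p]} (hv : ∀ k, 0 < k → k < 2 * h + 1 → (k : ℤ_[p]) * v k = 1) :
    (p : ℤ_[p]) ^ 2 ∣ ∑ j ∈ range (2 * h), v (j + 1) * v (2 * h - 1 - j + 1) := by
  have hp0 : (p : ℤ_[p]) ≠ 0 := mod_cast hp.out.ne_zero
  have hS := sq_dvd_sum_range_pow (p := p) (n := p - 3) (by omega) (by omega) hB
  have hD := sq_dvd_sum_pow_doubling (R := ℤ_[p]) h (p - 3)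
  have hI := sq_dvd_sum_inv_sq_doubling hv
  have hC := dvd_two_mul_sum_inv_cube hv
  have hU := sq_dvd_sum_inv_mul_inv_reflect hv
  rw [show p - 1 = 2 * h by omega] at hS
  rw [← hph] at hD hI hC hU
  have hT' : (p : ℤ_[p]) ∣ ∑ j ∈ range h, ((h + j + 1 : ℕ) : ℤ_[p]) ^ (p - 4) := by
    have h1 := (dvd_add_right (dvd_sub hS (hS.mul_left (2 ^ (p - 3))))).1 hD
    rw [show p - 3 - 1 = p - 4 by omega] at h1
    have h2 : (p : ℤ_[p]) ∣ ((p - 3 : ℕ) : ℤ_[p]) * (2 ^ (p - 4) *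
        ∑ j ∈ range h, ((h + j + 1 : ℕ) : ℤ_[p]) ^ (p - 4)) := by
      rw [← mul_dvd_mul_iff_left hp0]
      convert h1 using 1 <;> ring
    have h3 := padicInt_dvd_of_dvd_natCast_mul (by omega) (by omega) h2
    refine (PadicInt.prime_p.dvd_mul.1 h3).resolve_left fun h4 => ?_
    have h5 : (p : ℤ_[p]) ∣ ((2 : ℕ) : ℤ_[p]) * 1 := by
      simpa using PadicInt.prime_p.dvd_of_dvd_pow h4
    exact PadicInt.prime_p.not_dvd_one
      (padicInt_dvd_of_dvd_natCast_mul (by omega) (by omega) h5)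
  have hT : (p : ℤ_[p]) ∣ ∑ j ∈ range h, v (h + j + 1) ^ 3 := by
    refine (dvd_sub_right hT').1 ?_
    rw [← sum_sub_distrib]
    refine dvd_sum fun j hj => ?_
    have hj := mem_range.1 hj
    exact padicInt_dvd_pow_sub_inv_cube (by omega) (by omega) (by omega)
      (hv _ (by omega) (by omega))
  have hH : (p : ℤ_[p]) ^ 2 ∣ ∑ j ∈ range (2 * h), v (j + 1) ^ 2 := by
    refine padicInt_dvd_of_dvd_natCast_mul (k := 3) (by omega) (by omega) ?_
    refine (dvd_sub_left ?_).1 hI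
    rw [sq]
    exact mul_dvd_mul_left _ hT
  have hC' : (p : ℤ_[p]) ^ 2 ∣ p * ∑ j ∈ range (2 * h), v (j + 1) ^ 3 := by
    rw [sq]
    exact mul_dvd_mul_left _
      (padicInt_dvd_of_dvd_natCast_mul (k := 2) (by omega) (by omega) (mod_cast hC))
  exact (dvd_add_left hH).1 ((dvd_add_left hC').1 hU)

end Padic

/-- If `p ≥ 7` is a Wolstenholme prime, i.e. `p` divides the numerator of the
Bernoulli number `B_{p-3}` (equivalently, `B_{p-3} = 0` or its `p`-adic valuation
is at least `1`), then `C(2p-1, p-1) ≡ 1 (mod p⁴)`. -/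
theorem wolstenholme_prime_choose_congr (p : ℕ) (hp : p.Prime) (h7 : 7 ≤ p)
    (hB : bernoulli (p - 3) = 0 ∨ 1 ≤ padicValRat p (bernoulli (p - 3))) :
    (p : ℤ) ^ 4 ∣ ((Nat.choose (2 * p - 1) (p - 1) : ℤ) - 1) := by
  have : Fact p.Prime := ⟨hp⟩
  obtain ⟨h, hph⟩ : ∃ h, p = 2 * h + 1 := hp.odd_of_ne_two (by omega)
  obtain ⟨v, hv⟩ := exists_padicInt_inv (p := p)
  have hv' : ∀ k, 0 < k → k < 2 * h + 1 → (k : ℤ_[p]) * v k = 1 := fun k h0 hk =>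
    hv k h0 (by omega)
  have hU := sq_dvd_sum_inv_mul_inv_reflect_of_bernoulli hph h7 hB hv'
  have h1 := choose_eq_prod_one_add_mul_inv hv'
  have h2 := choose_sq_eq_prod hv'
  rw [show 2 * p - 1 = 2 * h + 1 + 2 * h by omega, show p - 1 = 2 * h by omega,
    ← PadicInt.pow_p_dvd_int_iff]
  push_cast
  generalize ((2 * h + 1 + 2 * h).choose (2 * h) : ℤ_[p]) = C at *
  rw [← hph] at h1 h2
  have hC1 : (p : ℤ_[p]) ∣ C - 1 := by
    obtain ⟨c, hc⟩ := sq_dvd_prod_one_add_mul_sub (range (2 * h)) (p : ℤ_[p]) (fun j => v (j + 1))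
    rw [← h1] at hc
    exact ⟨∑ j ∈ range (2 * h), v (j + 1) + p * c, by linear_combination hc⟩
  have hC2 : (p : ℤ_[p]) ^ 4 ∣ (C + 1) * (C - 1) := by
    obtain ⟨c, hc⟩ := sq_dvd_prod_one_add_mul_sub (range (2 * h)) ((p : ℤ_[p]) ^ 2)
      (fun j => 2 * (v (j + 1) * v (2 * h - 1 - j + 1)))
    obtain ⟨d, hd⟩ := hU
    rw [← h2, ← mul_sum, hd] at hc
    exact ⟨2 * d + c, by linear_combination hc⟩
  refine PadicInt.prime_p.pow_dvd_of_dvd_mul_left 4 (fun h3 => ?_) hC2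
  have h5 : (p : ℤ_[p]) ∣ ((2 : ℕ) : ℤ_[p]) * 1 := by
    have := dvd_sub h3 hC1
    ring_nf at this
    simpa using this
  exact PadicInt.prime_p.not_dvd_one
    (padicInt_dvd_of_dvd_natCast_mul (by omega) (by omega) h5)
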